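/- Let n ≥ 2, d ≥ 3, let f ∈ ℂ[z_1,…,z_n]_d be nondegenerate and let C ∈ GL_n(ℂ). Define (Cf)(z) := f(zC^{−T}) for z ∈ ℂ^n (row vector convention). Then Cf is nondegenerate, and the associated form of Cf equals (det C)² times the form e ↦ 𝐟(eC), where 𝐟 is the associated form of f and e = (e_1,…,e_n) is acted on by e ↦ eC. -/

import Mathlib

open MvPolynomial

noncomputable section

/-- The gradient ideal `(f_{z_1},…,f_{z_n})` of a form `f`. -/
def gradIdeal (n : ℕ) (f : MvPolynomial (Fin n) ℂ) : Ideal (MvPolynomial (Fin n) ℂ) :=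
  Ideal.span (Set.range fun i => pderiv i f)

/-- The Hessian `det (∂²f/∂z_i∂z_j)` of a form `f`. -/
def hess (n : ℕ) (f : MvPolynomial (Fin n) ℂ) : MvPolynomial (Fin n) ℂ :=
  Matrix.det (Matrix.of fun i j : Fin n => pderiv i (pderiv j f))

/-- `μ` is the system of coefficients defining the associated form of `f`:
for each multi-index `m` with `|m| = n(d-2)`, the scalar `μ m` satisfies
`z^m - μ m · Hess f ∈ (f_{z_1},…,f_{z_n})`. -/
def IsAssocCoeffs (n d : ℕ) (f : MvPolynomial (Fin n) ℂ) (μ : (Fin n → ℕ) → ℂ) : Prop :=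
  ∀ m : Fin n → ℕ, (∑ i, m i) = n * (d - 2) →
    (∏ i, X i ^ m i) - C (μ m) * hess n f ∈ gradIdeal n f

/-- The associated form `Σ_{|m| = n(d-2)} (n(d-2))!/(m_1!⋯m_n!) · μ m · e^m`
built from the coefficients `μ`. -/
def assocForm (n d : ℕ) (μ : (Fin n → ℕ) → ℂ) : MvPolynomial (Fin n) ℂ :=
  ∑ m ∈ Finset.Nat.antidiagonalTuple n (n * (d - 2)),
    C ((Nat.multinomial Finset.univ m : ℂ) * μ m) * ∏ i, X i ^ m i

end

theorem mem_span_X_pow_image_iff {σ R : Type*} [CommRing R] {N : ℕ} {T : Set σ}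
    {p : MvPolynomial σ R} :
    p ∈ Ideal.span ((fun k => (X k : MvPolynomial σ R) ^ N) '' T) ↔
      ∀ m ∈ p.support, ∃ k ∈ T, N ≤ m k := by
  have h : (fun k => (X k : MvPolynomial σ R) ^ N) '' T =
      (fun s => monomial s (1 : R)) '' ((fun k => Finsupp.single k N) '' T) := by
    simp only [Set.image_image, X_pow_eq_monomial]
  rw [h, mem_ideal_span_monomial_image]
  simp

/-- `X i` is a nonzerodivisor modulo powers of other variables. -/
theorem mem_span_X_pow_image_of_mul_X_mem {σ R : Type*} [CommRing R] {N : ℕ} {T : Set σ} {i : σ}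
    (hi : i ∉ T) {p : MvPolynomial σ R}
    (h : p * X i ∈ Ideal.span ((fun k => (X k : MvPolynomial σ R) ^ N) '' T)) :
    p ∈ Ideal.span ((fun k => (X k : MvPolynomial σ R) ^ N) '' T) := by
  classical
  rw [mem_span_X_pow_image_iff] at h ⊢
  intro m hm
  obtain ⟨k, hk, hle⟩ := h (m + Finsupp.single i 1) (by
    simpa [mem_support_iff, coeff_mul_X] using hm)
  have hki : i ≠ k := fun e => hi (e ▸ hk)
  exact ⟨k, hk, by simpa [Finsupp.single_apply, hki] using hle⟩

/-- A consequence of Cramer's rule. -/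
theorem Matrix.det_mul_mem_of_mulVec_mem {ι R : Type*} [Fintype ι] [DecidableEq ι] [CommRing R]
    (A : Matrix ι ι R) (v : ι → R) {I : Ideal R} (h : ∀ i, A.mulVec v i ∈ I) (j : ι) :
    A.det * v j ∈ I := by
  have e : A.adjugate.mulVec (A.mulVec v) j = A.det * v j := by
    rw [Matrix.mulVec_mulVec, Matrix.adjugate_mul, Matrix.smul_mulVec, Matrix.one_mulVec]
    rfl
  rw [← e]
  exact Ideal.sum_mem _ fun k _ => Ideal.mul_mem_left _ _ (h k)

/-- A matrix carrying the vector of variables to the vector of their `(N+1)`-st powers has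
determinant `∏ X i ^ N` modulo these powers. -/
theorem det_sub_prod_X_pow_mem {σ R : Type*} [Fintype σ] [DecidableEq σ] [CommRing R] (N : ℕ)
    (A : Matrix σ σ (MvPolynomial σ R)) (hA : ∀ i, A.mulVec X i = X i ^ (N + 1)) :
    A.det - ∏ i, X i ^ N ∈
      Ideal.span ((fun k => (X k : MvPolynomial σ R) ^ (N + 1)) '' Set.univ) := by
  set D : Matrix σ σ (MvPolynomial σ R) := Matrix.diagonal fun i => X i ^ N with hD
  have hDX : ∀ i, D.mulVec X i = X i ^ (N + 1) := fun i => by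
    rw [hD, Matrix.mulVec_diagonal, pow_succ]
  suffices H : ∀ s : Finset σ, ∀ A : Matrix σ σ (MvPolynomial σ R),
      (∀ i, A.mulVec X i = X i ^ (N + 1)) → (∀ i ∉ s, A i = D i) →
      A.det - ∏ i, X i ^ N ∈
        Ideal.span ((fun k => (X k : MvPolynomial σ R) ^ (N + 1)) '' Set.univ) from
    H Finset.univ A hA (by simp)
  intro s
  induction s using Finset.induction_on with
  | empty =>
    intro A _ h
    have : A = D := funext fun i => h i (by simp)
    rw [this, hD, Matrix.det_diagonal, sub_self]
    exact zero_mem _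
  | insert i s his ih =>
    intro A hA h
    have hdet : A.det = (A.updateRow i (A i - D i)).det + (A.updateRow i (D i)).det := by
      rw [← Matrix.det_updateRow_add, sub_add_cancel, Matrix.updateRow_eq_self]
    have hB : ∀ k, (A.updateRow i (D i)).mulVec X k = X k ^ (N + 1) := fun k => by
      by_cases hk : k = i
      · subst hk
        rw [← hDX k]
        simp [Matrix.mulVec]
      · rw [← hA k]
        simp [Matrix.mulVec, Matrix.updateRow_ne hk]
    have hrest := ih (A.updateRow i (D i)) hB fun k hk => by
      by_cases hki : k = i
      · subst hki
        simp
      · rw [Matrix.updateRow_ne hki, h k (by simp [hki, hk])]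
    have hdiff : (A.updateRow i (A i - D i)).det ∈
        Ideal.span ((fun k => (X k : MvPolynomial σ R) ^ (N + 1)) '' {i}ᶜ) := by
      refine mem_span_X_pow_image_of_mul_X_mem (i := i) (by simp) ?_
      refine Matrix.det_mul_mem_of_mulVec_mem _ X (fun k => ?_) i
      by_cases hk : k = i
      · subst hk
        have : (A.updateRow k (A k - D k)).mulVec X k = A.mulVec X k - D.mulVec X k := by
          simp [Matrix.mulVec, dotProduct, sub_mul]
        rw [this, hA, hDX, sub_self]
        exact zero_mem _
      · have : (A.updateRow i (A i - D i)).mulVec X k = A.mulVec X k := by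
          simp [Matrix.mulVec, Matrix.updateRow_ne hk]
        rw [this, hA]
        exact Ideal.subset_span ⟨k, hk, rfl⟩
    rw [hdet, add_sub_assoc]
    exact add_mem (Ideal.span_mono (Set.image_mono (Set.subset_univ _)) hdiff) hrest

theorem prod_X_pow_notMem {σ R : Type*} [Fintype σ] [CommRing R] [Nontrivial R] (N : ℕ) :
    (∏ i, X i ^ N : MvPolynomial σ R) ∉
      Ideal.span ((fun k => (X k : MvPolynomial σ R) ^ (N + 1)) '' Set.univ) := by
  classical
  intro h
  have e : (∏ i, X i ^ N : MvPolynomial σ R) =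
      monomial (Finsupp.equivFunOnFinite.symm fun _ => N) 1 := by
    rw [monomial_eq, Finsupp.prod_fintype _ _ (by simp)]
    simp
  rw [e, mem_span_X_pow_image_iff] at h
  obtain ⟨k, -, hk⟩ := h (Finsupp.equivFunOnFinite.symm fun _ => N) (by
    simp [mem_support_iff])
  simp at hk

/-- If `g = A z` and the ideal `(g)` contains a power of each variable, then `det A ∉ (g)`. -/
theorem det_notMem_span_of_mulVec_X {σ R : Type*} [Fintype σ] [DecidableEq σ] [CommRing R]
    [Nontrivial R] (A : Matrix σ σ (MvPolynomial σ R)) (N : ℕ)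
    (h : ∀ i, (X i : MvPolynomial σ R) ^ (N + 1) ∈ Ideal.span (Set.range (A.mulVec X))) :
    A.det ∉ Ideal.span (Set.range (A.mulVec X)) := by
  intro hdet
  have h' : ∀ i, ∃ b : σ → MvPolynomial σ R, ∑ j, b j * A.mulVec X j = X i ^ (N + 1) :=
    fun i => Ideal.mem_span_range_iff_exists_fun.1 (h i)
  choose b hb using h'
  set B : Matrix σ σ (MvPolynomial σ R) := Matrix.of b
  have hBA : ∀ i, (B * A).mulVec X i = X i ^ (N + 1) := fun i => by
    rw [← Matrix.mulVec_mulVec, ← hb i]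
    rfl
  have hmem : B.det * A.det ∈
      Ideal.span ((fun k => (X k : MvPolynomial σ R) ^ (N + 1)) '' Set.univ) := by
    obtain ⟨c, hc⟩ := Ideal.mem_span_range_iff_exists_fun.1 hdet
    rw [← hc, Finset.mul_sum]
    refine Ideal.sum_mem _ fun j _ => ?_
    rw [mul_left_comm]
    refine Ideal.mul_mem_left _ _ (Matrix.det_mul_mem_of_mulVec_mem B _ (fun i => ?_) j)
    rw [Matrix.mulVec_mulVec, hBA]
    exact Ideal.subset_span ⟨i, trivial, rfl⟩
  have hsub := det_sub_prod_X_pow_mem N (B * A) hBA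
  rw [Matrix.det_mul] at hsub
  exact prod_X_pow_notMem N ((Submodule.sub_mem_iff_right _ hmem).1 hsub)

/-- The Hessian of a nondegenerate form does not lie in the gradient ideal. -/
theorem hess_notMem_gradIdeal {n d : ℕ} (hd : 2 ≤ d) {f : MvPolynomial (Fin n) ℂ}
    (hf : f.IsHomogeneous d)
    (hnd : ∀ p : Fin n → ℂ, (∀ i, eval p (pderiv i f) = 0) → p = 0) :
    hess n f ∉ gradIdeal n f := by
  have hd0 : ((d - 1 : ℕ) : ℂ) ≠ 0 := Nat.cast_ne_zero.2 (by omega)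
  have hXrad : ∀ i : Fin n, (X i : MvPolynomial (Fin n) ℂ) ∈ (gradIdeal n f).radical := fun i => by
    rw [← vanishingIdeal_zeroLocus_eq_radical (K := ℂ), mem_vanishingIdeal_iff]
    intro p hp
    rw [gradIdeal, zeroLocus_span] at hp
    have : p = 0 := hnd p fun j => by
      simpa [coe_aeval_eq_eval] using hp _ ⟨j, rfl⟩
    simp [this]
  choose N hN using hXrad
  have hpow : ∀ i : Fin n, (X i : MvPolynomial (Fin n) ℂ) ^ (∑ j, N j + 1) ∈ gradIdeal n f :=
    fun i => Ideal.mem_of_dvd _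
      (pow_dvd_pow _ ((Finset.single_le_sum (fun _ _ => Nat.zero_le _)
        (Finset.mem_univ i)).trans (Nat.le_succ _))) (hN i)
  set H : Matrix (Fin n) (Fin n) (MvPolynomial (Fin n) ℂ) :=
    Matrix.of fun i j => pderiv i (pderiv j f)
  -- Euler's identity for the partial derivatives.
  have hEuler : ∀ j, H.transpose.mulVec X j = C ((d - 1 : ℕ) : ℂ) * pderiv j f := fun j => by
    have := (hf.pderiv (i := j)).sum_X_mul_pderiv
    rw [nsmul_eq_mul, ← map_natCast (C (σ := Fin n) (R := ℂ))] at this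
    rw [← this]
    simp [Matrix.mulVec, dotProduct, H, mul_comm]
  have hspan : Ideal.span (Set.range (H.transpose.mulVec X)) = gradIdeal n f := by
    apply le_antisymm
    · rw [Ideal.span_le]
      rintro _ ⟨j, rfl⟩
      rw [hEuler]
      exact Ideal.mul_mem_left _ _ (Ideal.subset_span ⟨j, rfl⟩)
    · rw [gradIdeal, Ideal.span_le]
      rintro _ ⟨j, rfl⟩
      have : pderiv j f = C ((d - 1 : ℕ) : ℂ)⁻¹ * H.transpose.mulVec X j := by
        rw [hEuler, ← mul_assoc, ← C_mul, inv_mul_cancel₀ hd0, C_1, one_mul]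
      simp only [this]
      exact Ideal.mul_mem_left _ _ (Ideal.subset_span ⟨j, rfl⟩)
  rw [← hspan] at hpow ⊢
  have := det_notMem_span_of_mulVec_X H.transpose _ hpow
  rwa [Matrix.det_transpose] at this

/-- The linear form `h_v := ∑ i, v i • z_i` satisfies `h_v ^ (n (d - 2)) ≡ 𝐟(v) Hess f` modulo the
gradient ideal. -/
theorem IsAssocCoeffs.linear_pow_sub_mem {n d : ℕ} {f : MvPolynomial (Fin n) ℂ}
    {μ : (Fin n → ℕ) → ℂ} (hμ : IsAssocCoeffs n d f μ) (v : Fin n → ℂ) :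
    (∑ i, C (v i) * X i) ^ (n * (d - 2)) - C (eval v (assocForm n d μ)) * hess n f ∈
      gradIdeal n f := by
  have key : (∑ i, C (v i) * X i) ^ (n * (d - 2)) - C (eval v (assocForm n d μ)) * hess n f =
      ∑ m ∈ Finset.Nat.antidiagonalTuple n (n * (d - 2)),
        C ((Nat.multinomial Finset.univ m : ℂ) * ∏ i, v i ^ m i) *
          ((∏ i, X i ^ m i) - C (μ m) * hess n f) := by
    rw [Finset.sum_pow_eq_sum_piAntidiag, Finset.piAntidiag_univ_fin_eq_antidiagonalTuple,
      assocForm, map_sum, map_sum, Finset.sum_mul, ← Finset.sum_sub_distrib]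
    refine Finset.sum_congr rfl fun m _ => ?_
    simp only [mul_pow, Finset.prod_mul_distrib, map_mul, map_prod, map_pow, eval_C, eval_X,
      map_natCast]
    ring
  rw [key]
  exact Ideal.sum_mem _ fun m hm => Ideal.mul_mem_left _ _
    (hμ m (Finset.Nat.mem_antidiagonalTuple.1 hm))

/-- The chain rule for a linear change of variables. -/
theorem pderiv_aeval_linear {σ R : Type*} [Fintype σ] [CommRing R] (B : Matrix σ σ R)
    (f : MvPolynomial σ R) (j : σ) :
    pderiv j (aeval (fun i => ∑ k, B i k • (X k : MvPolynomial σ R)) f) =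
      ∑ i, C (B i j) * aeval (fun i => ∑ k, B i k • (X k : MvPolynomial σ R)) (pderiv i f) := by
  classical
  induction f using MvPolynomial.induction_on with
  | C a => simp [algebraMap_eq]
  | add p q hp hq => simp only [map_add, hp, hq, mul_add, Finset.sum_add_distrib]
  | mul_X p i hp =>
    have hX : pderiv j (∑ k, B i k • (X k : MvPolynomial σ R)) = C (B i j) := by
      simp [pderiv_X, Pi.single_apply, smul_eq_C_mul]
    have hl : ∀ l, (pderiv l (X i) : MvPolynomial σ R) = if i = l then 1 else 0 := fun l => by
      rw [pderiv_X, Pi.single_apply]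
    simp only [map_mul, aeval_X, pderiv_mul, hX, hp, hl, map_add, mul_add,
      Finset.sum_add_distrib, Finset.sum_mul, mul_assoc]
    simp [apply_ite, mul_comm]

theorem hess_aeval_linear {n : ℕ} (B : Matrix (Fin n) (Fin n) ℂ) (f : MvPolynomial (Fin n) ℂ) :
    hess n (aeval (fun i => ∑ k, B i k • X k) f) =
      C (B.det ^ 2) * aeval (fun i => ∑ k, B i k • X k) (hess n f) := by
  set φ : MvPolynomial (Fin n) ℂ →ₐ[ℂ] MvPolynomial (Fin n) ℂ :=
    aeval fun i => ∑ k, B i k • X k with hφ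
  have hmat : (Matrix.of fun i j : Fin n => pderiv i (pderiv j (φ f))) =
      (B.map C).transpose * (Matrix.of fun i j => pderiv i (pderiv j f)).map φ * B.map C := by
    ext1 i j
    simp only [Matrix.of_apply, Matrix.mul_apply, Matrix.transpose_apply, Matrix.map_apply]
    rw [hφ, pderiv_aeval_linear, map_sum]
    refine Finset.sum_congr rfl fun k _ => ?_
    rw [pderiv_C_mul, pderiv_aeval_linear, mul_comm]
  have hB : (B.map C).det = (C B.det : MvPolynomial (Fin n) ℂ) := (RingHom.map_det C B).symm
  have hφdet := AlgHom.map_det φ (Matrix.of fun i j => pderiv i (pderiv j f))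
  rw [AlgHom.mapMatrix_apply] at hφdet
  rw [hess, hmat, Matrix.det_mul, Matrix.det_mul, Matrix.det_transpose, hB, ← hφdet, hess, C_pow]
  ring

/-- An invertible linear change of variables carries the gradient ideal of `f` into that of the
transformed form. -/
theorem aeval_linear_mem_gradIdeal {n : ℕ} {B : Matrix (Fin n) (Fin n) ℂ} (hB : IsUnit B.det)
    {f p : MvPolynomial (Fin n) ℂ} (hp : p ∈ gradIdeal n f) :
    aeval (fun i => ∑ k, B i k • (X k : MvPolynomial (Fin n) ℂ)) p ∈
      gradIdeal n (aeval (fun i => ∑ k, B i k • X k) f) := by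
  suffices h : gradIdeal n f ≤ (gradIdeal n (aeval (fun i => ∑ k, B i k • X k) f)).comap
      (aeval fun i => ∑ k, B i k • (X k : MvPolynomial (Fin n) ℂ)) from h hp
  rw [gradIdeal, Ideal.span_le]
  rintro _ ⟨i, rfl⟩
  have key : aeval (fun i => ∑ k, B i k • (X k : MvPolynomial (Fin n) ℂ)) (pderiv i f) =
      ∑ j, C (B⁻¹ j i) * pderiv j (aeval (fun i => ∑ k, B i k • X k) f) := by
    simp_rw [pderiv_aeval_linear, Finset.mul_sum]
    rw [Finset.sum_comm]
    have hone : ∀ l, ∑ j, B l j * B⁻¹ j i = (1 : Matrix (Fin n) (Fin n) ℂ) l i := fun l => by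
      rw [← Matrix.mul_nonsing_inv B hB, Matrix.mul_apply]
    have : ∀ l, ∑ j, C (B⁻¹ j i) * (C (B l j) *
          aeval (fun i => ∑ k, B i k • (X k : MvPolynomial (Fin n) ℂ)) (pderiv l f)) =
        C ((1 : Matrix (Fin n) (Fin n) ℂ) l i) *
          aeval (fun i => ∑ k, B i k • (X k : MvPolynomial (Fin n) ℂ)) (pderiv l f) := fun l => by
      rw [← hone, map_sum, Finset.sum_mul]
      refine Finset.sum_congr rfl fun j _ => ?_
      rw [C_mul]
      ring
    simp_rw [this]
    simp [Matrix.one_apply, apply_ite]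
  change aeval _ _ ∈ gradIdeal n _
  rw [key]
  exact Ideal.sum_mem _ fun j _ => Ideal.mul_mem_left _ _ (Ideal.subset_span ⟨j, rfl⟩)

theorem eval_aeval_linear {σ R : Type*} [Fintype σ] [CommRing R] (B : Matrix σ σ R) (v : σ → R)
    (f : MvPolynomial σ R) :
    eval v (aeval (fun i => ∑ k, B i k • (X k : MvPolynomial σ R)) f) =
      eval (B.mulVec v) f := by
  induction f using MvPolynomial.induction_on with
  | C a => simp [algebraMap_eq]
  | add p q hp hq => simp only [map_add, hp, hq]
  | mul_X p i hp =>
    rw [map_mul, map_mul, hp, aeval_X]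
    simp [Matrix.mulVec, dotProduct, smul_eval]

/-- An invertible linear change of variables preserves nondegeneracy. -/
theorem nondegenerate_aeval_linear {n : ℕ} {B : Matrix (Fin n) (Fin n) ℂ} (hB : IsUnit B.det)
    {f : MvPolynomial (Fin n) ℂ}
    (hnd : ∀ p : Fin n → ℂ, (∀ i, eval p (pderiv i f) = 0) → p = 0) (p : Fin n → ℂ)
    (hp : ∀ i, eval p (pderiv i (aeval (fun i => ∑ k, B i k • X k) f)) = 0) : p = 0 := by
  have hBp : B.mulVec p = 0 := hnd _ fun i => by
    rw [← eval_aeval_linear]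
    have hle : gradIdeal n (aeval (fun i => ∑ k, B i k • X k) f) ≤ RingHom.ker (eval p) := by
      rw [gradIdeal, Ideal.span_le]
      rintro _ ⟨j, rfl⟩
      exact hp j
    exact hle (aeval_linear_mem_gradIdeal hB (Ideal.subset_span ⟨i, rfl⟩))
  exact Matrix.eq_zero_of_mulVec_eq_zero hB.ne_zero hBp

/-- Equivariance of the associated form: for nondegenerate `f` of degree `d`
and `M ∈ GL_n(ℂ)`, the form `Mf : z ↦ f(zM^{-T})` is nondegenerate and its associated form
equals `(det M)²` times `e ↦ 𝐟(eM)`, where `𝐟` is the associated form of `f`. -/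
theorem assocForm_equivariance
    (n d : ℕ) (hn : 2 ≤ n) (hd : 3 ≤ d)
    (f : MvPolynomial (Fin n) ℂ) (hf : f.IsHomogeneous d)
    (hnd : ∀ p : Fin n → ℂ, (∀ i, eval p (pderiv i f) = 0) → p = 0)
    (M : Matrix (Fin n) (Fin n) ℂ) (hM : IsUnit M.det)
    (μ μ' : (Fin n → ℕ) → ℂ)
    (hμ : IsAssocCoeffs n d f μ)
    (hμ' : IsAssocCoeffs n d (aeval (fun i => ∑ j, M⁻¹ i j • X j) f) μ') :
    (∀ p : Fin n → ℂ,
        (∀ i, eval p (pderiv i (aeval (fun i => ∑ j, M⁻¹ i j • X j) f)) = 0) → p = 0)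
      ∧ assocForm n d μ'
          = M.det ^ 2 • aeval (fun i => ∑ j, M j i • X j) (assocForm n d μ) := by
  have hMinv : IsUnit M⁻¹.det := Matrix.isUnit_nonsing_inv_det M hM
  have hnd' := nondegenerate_aeval_linear hMinv hnd
  refine ⟨hnd', ?_⟩
  have hF : (aeval (fun i => ∑ j, M⁻¹ i j • (X j : MvPolynomial (Fin n) ℂ)) f).IsHomogeneous d := by
    have := hf.aeval (fun i => ∑ j, M⁻¹ i j • (X j : MvPolynomial (Fin n) ℂ)) (n := 1) fun i =>
      IsHomogeneous.sum _ _ _ fun j _ => by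
        rw [smul_eq_C_mul]
        exact (isHomogeneous_X ℂ j).C_mul _
    rwa [one_mul] at this
  have hhess := hess_notMem_gradIdeal (by omega) hF hnd'
  refine MvPolynomial.funext fun v => ?_
  have hsmul : eval v (M.det ^ 2 • aeval (fun i => ∑ j, M j i • X j) (assocForm n d μ)) =
      M.det ^ 2 * eval (M.transpose.mulVec v) (assocForm n d μ) := by
    rw [smul_eval, ← eval_aeval_linear]
    rfl
  rw [hsmul]
  have hlin : aeval (fun i => ∑ j, M⁻¹ i j • (X j : MvPolynomial (Fin n) ℂ))
      (∑ i, C (M.transpose.mulVec v i) * X i) = ∑ i, C (v i) * X i := by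
    have hv : ∀ k, ∑ i, M.transpose.mulVec v i * M⁻¹ i k = v k := fun k => by
      have : (M⁻¹).transpose.mulVec (M.transpose.mulVec v) = v := by
        rw [Matrix.mulVec_mulVec, ← Matrix.transpose_mul, Matrix.mul_nonsing_inv _ hM,
          Matrix.transpose_one, Matrix.one_mulVec]
      conv_rhs => rw [← this]
      exact Finset.sum_congr rfl fun i _ => mul_comm _ _
    simp only [map_sum, map_mul, aeval_X, aeval_C, algebraMap_eq, smul_eq_C_mul, Finset.mul_sum]
    rw [Finset.sum_comm]
    refine Finset.sum_congr rfl fun k _ => ?_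
    rw [← hv k, map_sum, Finset.sum_mul]
    exact Finset.sum_congr rfl fun i _ => by rw [C_mul, mul_assoc]
  have hnew := hμ'.linear_pow_sub_mem v
  have hold := aeval_linear_mem_gradIdeal hMinv (hμ.linear_pow_sub_mem (M.transpose.mulVec v))
  have hdet : M.det ^ 2 * M⁻¹.det ^ 2 = 1 := by
    rw [← mul_pow, ← Matrix.det_mul, Matrix.mul_nonsing_inv _ hM, Matrix.det_one, one_pow]
  have hhess_eq : aeval (fun i => ∑ j, M⁻¹ i j • (X j : MvPolynomial (Fin n) ℂ)) (hess n f) =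
      C (M.det ^ 2) * hess n (aeval (fun i => ∑ j, M⁻¹ i j • X j) f) := by
    rw [hess_aeval_linear, ← mul_assoc, ← C_mul, hdet, C_1, one_mul]
  rw [map_sub, map_pow, hlin, map_mul, hhess_eq, aeval_C, algebraMap_eq] at hold
  have hdiff := sub_mem hold hnew
  by_contra hne
  set c := eval v (assocForm n d μ') -
    M.det ^ 2 * eval (M.transpose.mulVec v) (assocForm n d μ) with hc
  have hc0 : c ≠ 0 := sub_ne_zero.2 hne
  have hcmem : C c * hess n (aeval (fun i => ∑ j, M⁻¹ i j • X j) f) ∈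
      gradIdeal n (aeval (fun i => ∑ j, M⁻¹ i j • X j) f) := by
    convert hdiff using 1
    rw [hc, C_sub, C_mul]
    ring
  refine hhess ?_
  have hcinv := Ideal.mul_mem_left _ (C c⁻¹) hcmem
  rwa [← mul_assoc, ← C_mul, inv_mul_cancel₀ hc0, C_1, one_mul] at hcinv
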